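/- arXiv:1409.3426 — 3 statements merged into one kernel-verified Lean document; each statement's English description precedes it below -/
import Mathlib

section
/- Let A and B be nonempty finite types and let P be a projection on ℂ^(A×B) that supports a quantum channel. Then Υ(P) = inf { Re(trace T) : T a Hermitian B×B matrix such that there exists a Hermitian (A×B)-indexed matrix F with F ≤ 1_A ⊗ T, Tr_B(F) = 1_A, and (1_{A×B} − P)·F·(1_{A×B} − P) ≤ 0 }. (Strong duality between the primal and dual SDP for the one-shot no-signalling assisted independence number.) -/
open Matrix Kronecker BigOperators
open scoped ComplexOrder

noncomputable section

/-- Loewner order: `M ≤ N` iff `N - M` is positive semidefinite. -/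
def loe {n : Type*} [Fintype n] (M N : Matrix n n ℂ) : Prop := (N - M).PosSemidef

/-- A projection: Hermitian and idempotent. -/
def IsProj {n : Type*} [Fintype n] (M : Matrix n n ℂ) : Prop := M.IsHermitian ∧ M * M = M

variable {A B : Type*} [Fintype A] [Fintype B] [DecidableEq A] [DecidableEq B]

/-- Partial trace over `A`. -/
def trA (M : Matrix (A × B) (A × B) ℂ) : Matrix B B ℂ :=
  Matrix.of fun b b' => ∑ a, M (a, b) (a, b')

/-- Partial trace over `B`. -/
def trB (M : Matrix (A × B) (A × B) ℂ) : Matrix A A ℂ :=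
  Matrix.of fun a a' => ∑ b, M (a, b) (a', b)

/-- `P` supports a quantum channel: there is a PSD `J` supported on `P` with `Tr_B J = 1`. -/
def SupportsChannel (P : Matrix (A × B) (A × B) ℂ) : Prop :=
  ∃ J : Matrix (A × B) (A × B) ℂ, J.PosSemidef ∧ P * J = J ∧ trB J = 1

/-- One-shot no-signalling assisted independence number (primal SDP). -/
def Upsilon (P : Matrix (A × B) (A × B) ℂ) : ℝ :=
  sSup { x : ℝ | ∃ S : Matrix A A ℂ, S.IsHermitian ∧ x = S.trace.re ∧
    ∃ E : Matrix (A × B) (A × B) ℂ,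
      loe 0 E ∧ loe E (S ⊗ₖ (1 : Matrix B B ℂ)) ∧ trA E = 1 ∧
      (P * (S ⊗ₖ (1 : Matrix B B ℂ) - E)).trace = 0 }

set_option linter.unusedSectionVars false
set_option linter.unusedSimpArgs false

section helpers
variable {n : Type*} [Fintype n] [DecidableEq n]

lemma aux_rep (f : Matrix n n ℂ →ₗ[ℝ] ℝ) :
    ∃ E : Matrix n n ℂ, ∀ M, f M = (E * M).trace.re := by
  refine ⟨Matrix.of fun i j => (f (Matrix.single j i 1) : ℂ) - Complex.I * f (Matrix.single j i Complex.I), ?_⟩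
  intro M
  have h1 : ∀ (i j : n) (z : ℂ), f (Matrix.single i j z) =
      z.re * f (Matrix.single i j 1) + z.im * f (Matrix.single i j Complex.I) := by
    intro i j z
    have : Matrix.single i j z = z.re • Matrix.single i j (1:ℂ) + z.im • Matrix.single i j Complex.I := by
      rw [Matrix.smul_single, Matrix.smul_single, ← Matrix.single_add]
      congr 1
      simp [Complex.re_add_im]
    rw [this, map_add, map_smul, map_smul]; simp
  conv_lhs => rw [Matrix.matrix_eq_sum_single M]
  simp only [map_sum, Matrix.trace, Matrix.diag, Matrix.mul_apply, Complex.re_sum]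
  rw [Finset.sum_comm]
  refine Finset.sum_congr rfl fun i _ => Finset.sum_congr rfl fun j _ => ?_
  rw [h1]
  simp
  ring

lemma aux_trace_nonneg {M N : Matrix n n ℂ} (hM : M.PosSemidef) (hN : N.PosSemidef) :
    0 ≤ (M * N).trace.re := by
  obtain ⟨C, rfl⟩ : ∃ C, N = Cᴴ * C := by
    open scoped MatrixOrder Matrix.Norms.L2Operator in
    exact CStarAlgebra.nonneg_iff_eq_star_mul_self.1 hN.nonneg
  have h := (hM.mul_mul_conjTranspose_same C).trace_nonneg
  rw [← Matrix.mul_assoc, Matrix.trace_mul_comm, ← Matrix.mul_assoc]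
  exact (Complex.le_def.1 h).1

/-- matrices whose Hermitian part is positive semidefinite -/
def KK (n : Type*) [Fintype n] : Set (Matrix n n ℂ) := {Q | (Q + Qᴴ).PosSemidef}

lemma aux_smul {c : ℝ} (hc : 0 ≤ c) {M : Matrix n n ℂ} (h : M.PosSemidef) : (c • M).PosSemidef :=
  h.smul hc

lemma KK_convex : Convex ℝ (KK n) := by
  intro x hx y hy a b ha hb _
  have h := (aux_smul ha hx).add (aux_smul hb hy)
  show ((a • x + b • y) + (a • x + b • y)ᴴ).PosSemidef
  convert h using 1
  simp [Matrix.conjTranspose_smul, smul_add]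
  abel

lemma aux_le_norm (D : Matrix n n ℂ) (hD : D.IsHermitian) :
    ∃ c : ℝ, 0 ≤ c ∧ (c • (1 : Matrix n n ℂ) - D).PosSemidef := by
  open scoped MatrixOrder Matrix.Norms.L2Operator in
  exact ⟨‖D‖, norm_nonneg _, by
    have := IsSelfAdjoint.le_algebraMap_norm_self (a := D) hD
    rw [Matrix.le_iff] at this
    rwa [Algebra.algebraMap_eq_smul_one] at this⟩

lemma KK_interior {R : Matrix n n ℂ} (hR : R.PosSemidef) : 1 + R ∈ interior (KK n) := by
  open scoped MatrixOrder Matrix.Norms.L2Operator in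
  rw [mem_interior_iff_mem_nhds]
  have hc : Continuous fun Q : Matrix n n ℂ => ‖(1 + R - Q) + (1 + R - Q)ᴴ‖ := by fun_prop
  have : {Q : Matrix n n ℂ | ‖(1 + R - Q) + (1 + R - Q)ᴴ‖ < 2} ∈ nhds (1 + R) := by
    apply (isOpen_lt hc continuous_const).mem_nhds
    simp
  refine Filter.mem_of_superset this ?_
  intro Q hQ
  have hs : ((1 + R - Q) + (1 + R - Q)ᴴ).IsHermitian := Matrix.isHermitian_add_transpose_self _
  have h := IsSelfAdjoint.le_algebraMap_norm_self (a := (1 + R - Q) + (1 + R - Q)ᴴ) hs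
  rw [Matrix.le_iff, Algebra.algebraMap_eq_smul_one] at h
  have h2 := aux_smul (M := (1 : Matrix n n ℂ)) (sub_nonneg.2 (le_of_lt hQ)) Matrix.PosSemidef.one
  have h3 := (h.add h2).add (hR.add hR)
  show (Q + Qᴴ).PosSemidef
  refine (congrArg Matrix.PosSemidef ?_).mp h3
  simp only [sub_smul, two_smul, Matrix.conjTranspose_sub, Matrix.conjTranspose_add,
    Matrix.conjTranspose_one, hR.isHermitian.eq]
  abel

lemma aux_eq_zero {N : Matrix n n ℂ} (hN : N.IsHermitian) (h : (N * N).trace.re = 0) : N = 0 := by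
  have h1 : (Nᴴ * N).PosSemidef := Matrix.posSemidef_conjTranspose_mul_self N
  have h2 : (Nᴴ * N).trace = 0 := by
    have h3 := h1.trace_nonneg
    apply Complex.ext
    · rw [hN.eq]; exact h
    · exact (Complex.le_def.1 h3).2.symm
  exact Matrix.trace_conjTranspose_mul_self_eq_zero_iff.1 h2

lemma aux_psd (E : Matrix n n ℂ) (h : ∀ Q ∈ KK n, 0 ≤ (E * Q).trace.re) : E.PosSemidef := by
  have hherm : E.IsHermitian := by
    have key : ∀ Q : Matrix n n ℂ, Qᴴ = -Q → (E * Q).trace.re = 0 := by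
      intro Q hQ
      have h1 := h Q (by show (Q + Qᴴ).PosSemidef; rw [hQ]; simpa using Matrix.PosSemidef.zero)
      have h2 := h (-Q) (by
        show ((-Q) + (-Q)ᴴ).PosSemidef; rw [Matrix.conjTranspose_neg, hQ]
        simpa using Matrix.PosSemidef.zero)
      simp at h2
      linarith
    have k1 := key (E - Eᴴ) (by simp)
    have k2 : (Eᴴ * (E - Eᴴ)).trace.re = 0 := by
      have : (Eᴴ * (E - Eᴴ)).trace = - star ((E * (E - Eᴴ)).trace) := by
        rw [← Matrix.trace_conjTranspose, Matrix.conjTranspose_mul, Matrix.trace_mul_comm,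
          ← Matrix.trace_neg, Matrix.conjTranspose_sub, Matrix.conjTranspose_conjTranspose,
          ← Matrix.neg_mul, neg_sub]
      rw [this]; simpa using k1
    have k3 : ((E - Eᴴ)ᴴ * (E - Eᴴ)).trace = 0 := by
      have h3 := (Matrix.posSemidef_conjTranspose_mul_self (E - Eᴴ)).trace_nonneg
      apply Complex.ext
      · rw [Matrix.conjTranspose_sub, Matrix.conjTranspose_conjTranspose, Matrix.sub_mul,
          Matrix.trace_sub, Complex.sub_re, k1, k2]; simp
      · exact (Complex.le_def.1 h3).2.symm
    have k4 := Matrix.trace_conjTranspose_mul_self_eq_zero_iff.1 k3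
    exact (sub_eq_zero.1 k4).symm
  refine Matrix.posSemidef_iff_dotProduct_mulVec.2 ⟨hherm, fun x => ?_⟩
  have hx := Matrix.posSemidef_vecMulVec_self_star x
  have h1 := h (Matrix.vecMulVec x (star x)) (by
    show (Matrix.vecMulVec x (star x) + (Matrix.vecMulVec x (star x))ᴴ).PosSemidef
    rw [hx.isHermitian.eq]; exact hx.add hx)
  have h2 : (E * Matrix.vecMulVec x (star x)).trace = star x ⬝ᵥ (E *ᵥ x) := by
    rw [Matrix.mul_vecMulVec, Matrix.trace_vecMulVec, dotProduct_comm]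
  rw [h2] at h1
  refine Complex.le_def.2 ⟨h1, ?_⟩
  have := hherm.im_star_dotProduct_mulVec_self x
  simpa using this.symm

lemma aux_lin {V : Type*} [AddCommGroup V] [Module ℝ V] (g : V →ₗ[ℝ] ℝ) (c : ℝ) (x : V)
    (h : ∀ t : ℝ, c ≤ g (t • x)) : g x = 0 := by
  by_contra hne
  have := h ((c - 1) / g x)
  rw [map_smul, smul_eq_mul, div_mul_cancel₀ _ hne] at this
  linarith

end helpers

lemma trB_add (M N : Matrix (A × B) (A × B) ℂ) : trB (M + N) = trB M + trB N := by
  ext; simp [trB, Finset.sum_add_distrib]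

lemma trB_sub (M N : Matrix (A × B) (A × B) ℂ) : trB (M - N) = trB M - trB N := by
  ext; simp [trB, Finset.sum_sub_distrib]

lemma trB_smul (c : ℝ) (M : Matrix (A × B) (A × B) ℂ) : trB (c • M) = c • trB M := by
  ext; simp [trB, Finset.mul_sum]

lemma trB_herm {M : Matrix (A × B) (A × B) ℂ} (h : M.IsHermitian) : (trB M).IsHermitian := by
  ext a a'
  simp only [trB, Matrix.conjTranspose_apply, Matrix.of_apply, star_sum]
  exact Finset.sum_congr rfl fun b _ => h.apply _ _

lemma trA_herm {M : Matrix (A × B) (A × B) ℂ} (h : M.IsHermitian) : (trA M).IsHermitian := by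
  ext a a'
  simp only [trA, Matrix.conjTranspose_apply, Matrix.of_apply, star_sum]
  exact Finset.sum_congr rfl fun b _ => h.apply _ _

lemma trace_trA (E : Matrix (A × B) (A × B) ℂ) (T : Matrix B B ℂ) :
    (E * ((1 : Matrix A A ℂ) ⊗ₖ T)).trace = (trA E * T).trace := by
  simp only [Matrix.trace, Matrix.diag, Matrix.mul_apply, trA, Matrix.of_apply,
    Matrix.kroneckerMap_apply, Fintype.sum_prod_type, Matrix.one_apply, ite_mul, one_mul, zero_mul,
    mul_ite, mul_zero, Finset.sum_mul]
  rw [Finset.sum_comm]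
  refine Finset.sum_congr rfl fun b _ => ?_
  rw [Finset.sum_comm]
  conv_rhs => rw [Finset.sum_comm]
  simp [Finset.sum_ite_eq]

lemma trace_trB (E : Matrix (A × B) (A × B) ℂ) (S : Matrix A A ℂ) :
    (E * (S ⊗ₖ (1 : Matrix B B ℂ))).trace = (trB E * S).trace := by
  simp only [Matrix.trace, Matrix.diag, Matrix.mul_apply, trB, Matrix.of_apply,
    Matrix.kroneckerMap_apply, Fintype.sum_prod_type, Matrix.one_apply, ite_mul, one_mul, zero_mul,
    mul_ite, mul_zero, mul_one, Finset.sum_mul, Finset.sum_ite_eq', Finset.sum_ite_eq, Finset.mem_univ, if_true]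
  refine Finset.sum_congr rfl fun a _ => ?_
  rw [Finset.sum_comm]

lemma trB_left (X : Matrix A A ℂ) (J : Matrix (A × B) (A × B) ℂ) :
    trB ((X ⊗ₖ (1 : Matrix B B ℂ)) * J) = X * trB J := by
  ext a a'
  simp only [trB, Matrix.mul_apply, Matrix.of_apply,
    Matrix.kroneckerMap_apply, Fintype.sum_prod_type, Matrix.one_apply, ite_mul, one_mul, zero_mul,
    mul_ite, mul_zero, mul_one, Finset.mul_sum, Finset.sum_ite_eq', Finset.sum_ite_eq, Finset.mem_univ, if_true]
  rw [Finset.sum_comm]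

lemma trB_right (X : Matrix A A ℂ) (J : Matrix (A × B) (A × B) ℂ) :
    trB (J * (X ⊗ₖ (1 : Matrix B B ℂ))) = trB J * X := by
  ext a a'
  simp only [trB, Matrix.mul_apply, Matrix.of_apply,
    Matrix.kroneckerMap_apply, Fintype.sum_prod_type, Matrix.one_apply, ite_mul, one_mul, zero_mul,
    mul_ite, mul_zero, mul_one, Finset.sum_mul, Finset.sum_ite_eq', Finset.sum_ite_eq, Finset.mem_univ, if_true]
  rw [Finset.sum_comm]

lemma trB_single (X : Matrix A A ℂ) (b : B) :
    trB (X ⊗ₖ (Matrix.single b b (1 : ℂ))) = X := by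
  ext a a'
  simp [trB, Matrix.single_apply]

lemma trace_single (M : Matrix (A × B) (A × B) ℂ) (X : Matrix A A ℂ) (b : B) :
    (M * (X ⊗ₖ (Matrix.single b b (1 : ℂ)))).trace
      = ((Matrix.of fun a a' => M (a, b) (a', b)) * X).trace := by
  simp [Matrix.trace, Matrix.mul_apply, Fintype.sum_prod_type, Matrix.single_apply, ite_and]

lemma kron_herm {X : Matrix A A ℂ} {Y : Matrix B B ℂ} (hX : X.IsHermitian) (hY : Y.IsHermitian) :
    (X ⊗ₖ Y).IsHermitian := by
  show (X ⊗ₖ Y)ᴴ = X ⊗ₖ Y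
  rw [Matrix.conjTranspose_kronecker, hX.eq, hY.eq]

lemma aux_weak {P : Matrix (A × B) (A × B) ℂ} (hP : IsProj P)
    {S : Matrix A A ℂ} {E F : Matrix (A × B) (A × B) ℂ} {T : Matrix B B ℂ}
    (h1 : loe 0 E) (h2 : loe E (S ⊗ₖ (1 : Matrix B B ℂ))) (h3 : trA E = 1)
    (h4 : (P * (S ⊗ₖ (1 : Matrix B B ℂ) - E)).trace = 0)
    (h5 : loe F ((1 : Matrix A A ℂ) ⊗ₖ T)) (h6 : trB F = 1)
    (h7 : loe ((1 - P) * F * (1 - P)) 0) : S.trace.re ≤ T.trace.re := by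
  unfold loe at *
  rw [sub_zero] at h1
  rw [zero_sub] at h7
  set U := S ⊗ₖ (1 : Matrix B B ℂ) - E with hU
  have hPU : P * U = 0 := by
    obtain ⟨C, hC⟩ : ∃ C, U = Cᴴ * C := by
      open scoped MatrixOrder Matrix.Norms.L2Operator in
      exact CStarAlgebra.nonneg_iff_eq_star_mul_self.1 h2.nonneg
    have : ((C * P)ᴴ * (C * P)).trace = 0 := by
      rw [Matrix.conjTranspose_mul, hP.1.eq, ← h4, hC]
      rw [Matrix.mul_assoc, Matrix.trace_mul_comm]
      simp only [Matrix.mul_assoc, hP.2]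
      conv_rhs => rw [Matrix.trace_mul_comm]
      simp only [Matrix.mul_assoc]
    have := Matrix.trace_conjTranspose_mul_self_eq_zero_iff.1 this
    have := congrArg Matrix.conjTranspose this
    rw [Matrix.conjTranspose_mul, hP.1.eq, Matrix.conjTranspose_zero] at this
    rw [hC, ← Matrix.mul_assoc, this, Matrix.zero_mul]
  have hUP : U * P = 0 := by
    have := congrArg Matrix.conjTranspose hPU
    rwa [Matrix.conjTranspose_mul, hP.1.eq, h2.isHermitian.eq, Matrix.conjTranspose_zero] at this
  have e1 := aux_trace_nonneg h1 h5
  have e2 := aux_trace_nonneg h2 h7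
  have e3 : (U * -((1 - P) * F * (1 - P))).trace = - (U * F).trace := by
    rw [Matrix.mul_neg, Matrix.trace_neg, ← Matrix.mul_assoc, Matrix.trace_mul_comm,
      ← Matrix.mul_assoc, ← Matrix.mul_assoc]
    congr 2
    simp [Matrix.sub_mul, Matrix.mul_sub, hPU, hUP]
  have e4 : (E * F).trace = S.trace - (U * F).trace := by
    have : E = S ⊗ₖ (1 : Matrix B B ℂ) - U := by rw [hU]; abel
    rw [this, Matrix.sub_mul, Matrix.trace_sub, Matrix.trace_mul_comm (S ⊗ₖ _), trace_trB, h6,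
      Matrix.one_mul]
  rw [Matrix.mul_sub, Matrix.trace_sub, trace_trA, h3, Matrix.one_mul, e4] at e1
  rw [e3] at e2
  simp at e1 e2
  linarith

lemma aux_slater {P J : Matrix (A × B) (A × B) ℂ} (hP : IsProj P) (hJ : J.PosSemidef)
    (hPJ : P * J = J) (htr : trB J = 1) :
    ∃ F : Matrix (A × B) (A × B) ℂ, F.IsHermitian ∧ trB F = 1 ∧
      (1 - P) * F * (1 - P) = -(1 - P) := by
  have hJP : J * P = J := by
    have := congrArg Matrix.conjTranspose hPJ
    rwa [Matrix.conjTranspose_mul, hP.1.eq, hJ.isHermitian.eq] at this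
  have hQ : (1 - P : Matrix (A × B) (A × B) ℂ).IsHermitian := Matrix.isHermitian_one.sub hP.1
  set X : Matrix A A ℂ := (1 / 2 : ℝ) • (1 + trB (1 - P)) with hX
  have hXh : X.IsHermitian := by
    have := Matrix.isHermitian_one.add (trB_herm hQ)
    show Xᴴ = X
    rw [hX, Matrix.conjTranspose_smul, this.eq]; simp
  have hXk := kron_herm hXh (Matrix.isHermitian_one (n := B) (α := ℂ))
  refine ⟨(X ⊗ₖ (1 : Matrix B B ℂ)) * J + J * (X ⊗ₖ (1 : Matrix B B ℂ)) - (1 - P), ?_, ?_, ?_⟩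
  · refine Matrix.IsHermitian.sub ?_ hQ
    show (_ + _)ᴴ = _
    rw [Matrix.conjTranspose_add, Matrix.conjTranspose_mul, Matrix.conjTranspose_mul, hXk.eq,
      hJ.isHermitian.eq, add_comm]
  · rw [trB_sub, trB_add, trB_left, trB_right, htr, Matrix.one_mul, Matrix.mul_one, hX,
      ← two_smul ℝ, smul_smul]
    norm_num
  · have a1 : (1 - P) * J = 0 := by rw [Matrix.sub_mul, hPJ, Matrix.one_mul, sub_self]
    have a2 : J * (1 - P) = 0 := by rw [Matrix.mul_sub, hJP, Matrix.mul_one, sub_self]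
    have a3 : (1 - P) * (1 - P) = 1 - P := by
      rw [Matrix.sub_mul, Matrix.mul_sub, Matrix.mul_sub, hP.2]; simp
    generalize (1 - P : Matrix (A × B) (A × B) ℂ) = Q at a1 a2 a3
    rw [Matrix.mul_sub, Matrix.mul_add, ← Matrix.mul_assoc Q J, a1, Matrix.zero_mul, add_zero,
      Matrix.sub_mul, a3, a3, Matrix.mul_assoc, Matrix.mul_assoc, a2, Matrix.mul_zero,
      Matrix.mul_zero, zero_sub]

lemma aux_smulh {n : Type*} (r : ℝ) (X : Matrix n n ℂ) (hX : X.IsHermitian) :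
    (r • X).IsHermitian := by
  show (r • X)ᴴ = r • X
  rw [Matrix.conjTranspose_smul, hX.eq, star_trivial]

lemma aux_sep (P : Matrix (A × B) (A × B) ℂ) (hP : IsProj P) (d : ℝ)
    (hd : ∀ (T : Matrix B B ℂ) (F : Matrix (A × B) (A × B) ℂ), T.IsHermitian → F.IsHermitian →
      loe F ((1 : Matrix A A ℂ) ⊗ₖ T) → trB F = 1 → loe ((1 - P) * F * (1 - P)) 0 →
      d ≤ T.trace.re)
    (F0 : Matrix (A × B) (A × B) ℂ) (hF0 : F0.IsHermitian) (hF0t : trB F0 = 1)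
    (hF0s : (1 - P) * F0 * (1 - P) = -(1 - P)) :
    ∃ E U : Matrix (A × B) (A × B) ℂ, E.PosSemidef ∧ U.PosSemidef ∧
      ∀ (T : Matrix B B ℂ) (F : Matrix (A × B) (A × B) ℂ), T.IsHermitian → F.IsHermitian →
      trB F = 1 →
      (E * ((1 : Matrix A A ℂ) ⊗ₖ T - F)).trace.re +
        (U * (P - (1 - P) * F * (1 - P))).trace.re ≤ T.trace.re - d := by
  have hQ : (1 - P : Matrix (A × B) (A × B) ℂ).IsHermitian := Matrix.isHermitian_one.sub hP.1
  have a3 : (1 - P) * (1 - P) = 1 - P := by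
    rw [Matrix.sub_mul, Matrix.mul_sub, Matrix.mul_sub, hP.2]; simp
  have a4 : (1 - P) * P = 0 := by
    rw [Matrix.sub_mul, hP.2]; simp
  have hPQ : P = 1 - (1 - P) := by abel
  let s : Set (Matrix (A × B) (A × B) ℂ × Matrix (A × B) (A × B) ℂ × ℝ) :=
    KK (A × B) ×ˢ (KK (A × B) ×ˢ Set.Iic (0 : ℝ))
  let t : Set (Matrix (A × B) (A × B) ℂ × Matrix (A × B) (A × B) ℂ × ℝ) :=
    {q | ∃ (T : Matrix B B ℂ) (F : Matrix (A × B) (A × B) ℂ), T.IsHermitian ∧ F.IsHermitian ∧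
      trB F = 1 ∧ q = ((1 : Matrix A A ℂ) ⊗ₖ T - F, P - (1 - P) * F * (1 - P), T.trace.re - d)}
  have hs : Convex ℝ s := KK_convex.prod (KK_convex.prod (convex_Iic 0))
  have ht : Convex ℝ t := by
    rintro _ ⟨T1, F1, hT1, hF1, ht1, rfl⟩ _ ⟨T2, F2, hT2, hF2, ht2, rfl⟩ a b ha hb hab
    refine ⟨a • T1 + b • T2, a • F1 + b • F2, ?_, ?_, ?_, ?_⟩
    · show (_ + _)ᴴ = _
      simp [Matrix.conjTranspose_smul, hT1.eq, hT2.eq]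
    · show (_ + _)ᴴ = _
      simp [Matrix.conjTranspose_smul, hF1.eq, hF2.eq]
    · rw [trB_add, trB_smul, trB_smul, ht1, ht2, ← add_smul, hab, one_smul]
    · have hb' : b = 1 - a := by linarith
      subst hb'
      refine Prod.ext ?_ (Prod.ext ?_ ?_)
      · simp only [Prod.fst_add, Prod.smul_fst, Matrix.kronecker_add, Matrix.kronecker_smul,
          smul_sub]
        abel
      · show a • (P - (1 - P) * F1 * (1 - P)) + (1 - a) • (P - (1 - P) * F2 * (1 - P))
          = P - (1 - P) * (a • F1 + (1 - a) • F2) * (1 - P)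
        simp only [Matrix.mul_add, Matrix.add_mul, Matrix.mul_smul, Matrix.smul_mul]
        module
      · simp
        ring
  have hint : interior s = interior (KK (A × B)) ×ˢ (interior (KK (A × B)) ×ˢ Set.Iio (0 : ℝ)) := by
    simp only [s, interior_prod_eq, interior_Iic]
  have hdisj : Disjoint (interior s) t := by
    rw [Set.disjoint_left]
    rintro _ hq ⟨T, F, hT, hF, htr, rfl⟩
    rw [hint] at hq
    obtain ⟨h1, h2, h3⟩ := hq
    replace h1 := interior_subset h1
    replace h2 := interior_subset h2
    simp only [Set.mem_Iio] at h3
    have half : ∀ M : Matrix (A × B) (A × B) ℂ, M.IsHermitian → M ∈ KK (A × B) →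
        M.PosSemidef := by
      intro M hM hK
      have hK' : (M + Mᴴ).PosSemidef := hK
      rw [hM.eq] at hK'
      have := aux_smul (c := 1/2) (by norm_num) hK'
      rw [← two_smul ℝ M, smul_smul] at this
      norm_num at this
      exact this
    have hFQ : ((1 - P) * F * (1 - P)).IsHermitian := by
      show (_ * _)ᴴ = _
      rw [Matrix.conjTranspose_mul, Matrix.conjTranspose_mul, hQ.eq, hF.eq, Matrix.mul_assoc]
    have g1 := half _ ((kron_herm Matrix.isHermitian_one hT).sub hF) h1
    have g2 := half _ (hP.1.sub hFQ) h2
    have g3 := g2.conjTranspose_mul_mul_same (1 - P)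
    have := hd T F hT hF g1 htr (by
      unfold loe
      rw [zero_sub]
      convert g3 using 1
      rw [hQ.eq]
      generalize (1 - P : Matrix (A × B) (A × B) ℂ) = Q at a3 a4
      rw [Matrix.mul_sub, a4, zero_sub, Matrix.neg_mul]
      congr 1
      rw [← Matrix.mul_assoc, ← Matrix.mul_assoc, a3, Matrix.mul_assoc (Q * F) Q Q, a3])
    linarith
  obtain ⟨f, u, hfs, hft⟩ := geometric_hahn_banach_open hs.interior isOpen_interior ht hdisj
  obtain ⟨c, hc0, hc⟩ := aux_le_norm F0 hF0
  have hone : (1 : Matrix (A × B) (A × B) ℂ) ∈ interior (KK (A × B)) := by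
    simpa using KK_interior (n := A × B) Matrix.PosSemidef.zero
  have hne : (interior s).Nonempty := by
    rw [hint]; exact ⟨(1, 1, -1), hone, hone, by simp⟩
  have hfs' : ∀ a ∈ s, f a ≤ u := by
    intro a ha
    have hcl : a ∈ closure (interior s) := by
      rw [hs.closure_interior_eq_closure_of_nonempty_interior hne]
      exact subset_closure ha
    exact closure_minimal (fun x hx => (hfs x hx).le) (isClosed_le f.continuous continuous_const) hcl
  have hcone : ∀ a ∈ s, ∀ r : ℝ, 0 ≤ r → r • a ∈ s := by
    rintro ⟨q1, q2, x⟩ ⟨h1, h2, h3⟩ r hr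
    have hk : ∀ q ∈ KK (A × B), r • q ∈ KK (A × B) := by
      intro q hq
      show (r • q + (r • q)ᴴ).PosSemidef
      have := aux_smul hr hq
      rwa [Matrix.conjTranspose_smul, star_trivial, ← smul_add]
    exact ⟨hk _ h1, hk _ h2, by
      simp only [Set.mem_Iic] at h3 ⊢
      exact mul_nonpos_of_nonneg_of_nonpos hr h3⟩
  have hu : 0 ≤ u := by
    obtain ⟨a, ha⟩ := hne
    have := hfs' _ (hcone a (interior_subset ha) 0 le_rfl)
    simpa using this
  have hneg : ∀ a ∈ s, f a ≤ 0 := by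
    intro a ha
    by_contra hpos
    push Not at hpos
    have := hfs' _ (hcone a ha ((u + 1) / f a) (by positivity))
    rw [map_smul, smul_eq_mul, div_mul_cancel₀ _ hpos.ne'] at this
    linarith
  have hzK : (0 : Matrix (A × B) (A × B) ℂ) ∈ KK (A × B) := by
    show (0 + 0ᴴ : Matrix (A × B) (A × B) ℂ).PosSemidef
    simpa using Matrix.PosSemidef.zero
  set l : ℝ := f (0, 0, 1) with hl
  have hsplit : ∀ q1 q2 r, f (q1, q2, r) = f (q1, 0, 0) + f (0, q2, 0) + r * l := by
    intro q1 q2 r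
    have : ((q1, q2, r) : Matrix (A × B) (A × B) ℂ × Matrix (A × B) (A × B) ℂ × ℝ)
        = (q1, 0, 0) + (0, q2, 0) + r • (0, 0, 1) := by simp
    rw [this, map_add, map_add, map_smul, smul_eq_mul]
  have hl0 : 0 ≤ l := by
    have := hneg (0, 0, -1) ⟨hzK, hzK, by simp⟩
    rw [hsplit] at this
    have z : f (0, 0, 0) = 0 := map_zero f
    rw [z] at this
    linarith
  have hlpos : 0 < l := by
    rcases hl0.lt_or_eq with h | h
    · exact h
    exfalso
    have m1 := hft _ ⟨(c + 1) • (1 : Matrix B B ℂ), F0, by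
      show (_)ᴴ = _
      simp [Matrix.conjTranspose_smul], hF0, hF0t, rfl⟩
    rw [hF0s, hsplit] at m1
    have m2 := hfs ((1 : Matrix A A ℂ) ⊗ₖ ((c + 1) • (1 : Matrix B B ℂ)) - F0, P - -(1 - P), -1) (by
      rw [hint]
      refine ⟨?_, ?_, by simp⟩
      · have := KK_interior hc
        convert this using 1
        rw [Matrix.kronecker_smul, Matrix.one_kronecker_one, add_smul, one_smul]
        abel
      · convert hone using 1
        simp)
    rw [hsplit, ← h] at m2
    rw [← h] at m1
    linarith
  obtain ⟨E, hE⟩ := aux_rep ((-(1 / l)) • (f.toLinearMap ∘ₗ LinearMap.inl ℝ _ _))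
  obtain ⟨U, hU⟩ := aux_rep ((-(1 / l)) • (f.toLinearMap ∘ₗ LinearMap.inr ℝ _ _ ∘ₗ LinearMap.inl ℝ _ _))
  have hE' : ∀ M, (E * M).trace.re = -(1 / l) * f (M, 0, 0) := fun M => (hE M).symm
  have hU' : ∀ M, (U * M).trace.re = -(1 / l) * f (0, M, 0) := fun M => (hU M).symm
  have hil : 0 < 1 / l := by positivity
  refine ⟨E, U, aux_psd E ?_, aux_psd U ?_, ?_⟩
  · intro Q hQ
    rw [hE']
    have := hneg (Q, 0, 0) ⟨hQ, hzK, by simp⟩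
    nlinarith
  · intro Q hQ
    rw [hU']
    have := hneg (0, Q, 0) ⟨hzK, hQ, by simp⟩
    nlinarith
  · intro T F hT hF htr
    have h1 := hu.trans (hft _ ⟨T, F, hT, hF, htr, rfl⟩)
    rw [hsplit] at h1
    rw [hE', hU']
    have h2 := mul_nonneg hil.le h1
    have h3 : 1 / l * l = 1 := by field_simp
    linear_combination h2 + (T.trace.re - d) * h3

lemma aux_strong [Nonempty B] (P : Matrix (A × B) (A × B) ℂ) (hP : IsProj P) (d : ℝ)
    (hd : ∀ (T : Matrix B B ℂ) (F : Matrix (A × B) (A × B) ℂ), T.IsHermitian → F.IsHermitian →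
      loe F ((1 : Matrix A A ℂ) ⊗ₖ T) → trB F = 1 → loe ((1 - P) * F * (1 - P)) 0 →
      d ≤ T.trace.re)
    (F0 : Matrix (A × B) (A × B) ℂ) (hF0 : F0.IsHermitian) (hF0t : trB F0 = 1)
    (hF0s : (1 - P) * F0 * (1 - P) = -(1 - P)) :
    ∃ S : Matrix A A ℂ, S.IsHermitian ∧ d ≤ S.trace.re ∧
    ∃ E : Matrix (A × B) (A × B) ℂ,
      loe 0 E ∧ loe E (S ⊗ₖ (1 : Matrix B B ℂ)) ∧ trA E = 1 ∧
      (P * (S ⊗ₖ (1 : Matrix B B ℂ) - E)).trace = 0 := by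
  obtain ⟨E, U, hE, hU, h⟩ := aux_sep P hP d hd F0 hF0 hF0t hF0s
  have hQ : (1 - P : Matrix (A × B) (A × B) ℂ).IsHermitian := Matrix.isHermitian_one.sub hP.1
  have a4 : P * (1 - P) = 0 := by
    rw [Matrix.mul_sub, hP.2]; simp
  set V := (1 - P) * U * (1 - P) with hV
  have hVp : V.PosSemidef := by
    have := hU.conjTranspose_mul_mul_same (1 - P)
    rwa [hQ.eq] at this
  have hUP : 0 ≤ (U * P).trace.re := by
    have : P.PosSemidef := by
      have := Matrix.posSemidef_conjTranspose_mul_self P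
      rwa [hP.1.eq, hP.2] at this
    exact aux_trace_nonneg hU this
  have hUF : ∀ F, (U * ((1 - P) * F * (1 - P))).trace = (V * F).trace := by
    intro F
    rw [hV, ← Matrix.mul_assoc, Matrix.trace_mul_comm]
    simp only [Matrix.mul_assoc]
  set M := E + V with hM
  have hMh : M.IsHermitian := hE.isHermitian.add hVp.isHermitian
  have key : ∀ (T : Matrix B B ℂ) (F : Matrix (A × B) (A × B) ℂ), T.IsHermitian → F.IsHermitian →
      trB F = 1 → (trA E * T).trace.re - T.trace.re + d ≤ (M * F).trace.re := by
    intro T F hT hF ht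
    have := h T F hT hF ht
    rw [Matrix.mul_sub, Matrix.mul_sub, Matrix.trace_sub, Matrix.trace_sub, trace_trA, hUF,
      Complex.sub_re, Complex.sub_re] at this
    rw [hM, Matrix.add_mul, Matrix.trace_add, Complex.add_re]
    linarith
  have hEA : trA E = 1 := by
    have hN : (trA E - 1).IsHermitian := (trA_herm hE.isHermitian).sub Matrix.isHermitian_one
    have : ∀ r : ℝ, r * ((trA E - 1) * (trA E - 1)).trace.re ≤ (M * F0).trace.re - d := by
      intro r
      have h1 := key (r • (trA E - 1)) F0 (aux_smulh r _ hN) hF0 hF0t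
      have h2 : (trA E * (r • (trA E - 1))).trace.re - (r • (trA E - 1)).trace.re
          = r * ((trA E - 1) * (trA E - 1)).trace.re := by
        rw [Matrix.sub_mul _ _ (trA E - 1), Matrix.mul_smul, Matrix.trace_smul, Matrix.trace_smul,
          Matrix.trace_sub (trA E * _), Matrix.one_mul]
        simp
        ring
      linarith
    have h0 : ((trA E - 1) * (trA E - 1)).trace.re = 0 := by
      by_contra hne
      have := this (((M * F0).trace.re - d + 1) / ((trA E - 1) * (trA E - 1)).trace.re)
      rw [div_mul_cancel₀ _ hne] at this
      linarith
    exact sub_eq_zero.1 (aux_eq_zero hN h0)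
  obtain ⟨b⟩ := ‹Nonempty B›
  set S : Matrix A A ℂ := Matrix.of fun a a' => M (a, b) (a', b) with hS
  have hSh : S.IsHermitian := by
    ext a a'
    simp only [hS, Matrix.conjTranspose_apply, Matrix.of_apply]
    exact hMh.apply _ _
  have hsingle : (Matrix.single b b (1 : ℂ)).IsHermitian := by
    show (_)ᴴ = _
    simp
  have hMS : M = S ⊗ₖ (1 : Matrix B B ℂ) := by
    set N := M - S ⊗ₖ (1 : Matrix B B ℂ) with hNd
    have hN : N.IsHermitian := hMh.sub (kron_herm hSh Matrix.isHermitian_one)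
    set G := N - trB N ⊗ₖ Matrix.single b b (1 : ℂ) with hG
    have hGh : G.IsHermitian := hN.sub (kron_herm (trB_herm hN) hsingle)
    have hG0 : trB G = 0 := by rw [hG, trB_sub, trB_single, sub_self]
    have hMG : (M * G).trace = (N * N).trace := by
      rw [hG, Matrix.mul_sub, Matrix.trace_sub, trace_single, ← hS]
      conv_rhs => rw [hNd]
      rw [Matrix.sub_mul, Matrix.trace_sub, ← hNd, Matrix.trace_mul_comm (S ⊗ₖ _), trace_trB,
        Matrix.trace_mul_comm S]
    have : ∀ r : ℝ, d ≤ (M * F0).trace.re + r * (N * N).trace.re := by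
      intro r
      have h1 := key 0 (F0 + r • G) Matrix.isHermitian_zero (hF0.add (aux_smulh r _ hGh)) (by
        rw [trB_add, trB_smul, hG0, hF0t]; simp)
      rw [Matrix.mul_add, Matrix.mul_smul, Matrix.trace_add, Matrix.trace_smul, hMG] at h1
      simpa using h1
    have h0 : (N * N).trace.re = 0 := by
      by_contra hne
      have := this ((d - (M * F0).trace.re - 1) / (N * N).trace.re)
      rw [div_mul_cancel₀ _ hne] at this
      linarith
    exact sub_eq_zero.1 (aux_eq_zero hN h0)
  have hVE : S ⊗ₖ (1 : Matrix B B ℂ) - E = V := by rw [← hMS, hM]; abel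
  refine ⟨S, hSh, ?_, E, ?_, ?_, hEA, ?_⟩
  · have h1 := key 0 F0 Matrix.isHermitian_zero hF0 hF0t
    rw [hMS, Matrix.trace_mul_comm (S ⊗ₖ _), trace_trB, hF0t, Matrix.one_mul] at h1
    simpa using h1
  · unfold loe; rwa [sub_zero]
  · unfold loe; rwa [hVE]
  · rw [hVE, hV, ← Matrix.mul_assoc, ← Matrix.mul_assoc, a4]; simp

/-- Strong duality for the one-shot no-signalling assisted independence number. -/
theorem upsilon_strong_duality [Nonempty A] [Nonempty B]
    (P : Matrix (A × B) (A × B) ℂ) (hP : IsProj P) (hch : SupportsChannel P) :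
    Upsilon P = sInf { x : ℝ | ∃ T : Matrix B B ℂ, T.IsHermitian ∧ x = T.trace.re ∧
      ∃ F : Matrix (A × B) (A × B) ℂ, F.IsHermitian ∧
        loe F ((1 : Matrix A A ℂ) ⊗ₖ T) ∧ trB F = 1 ∧
        loe ((1 - P) * F * (1 - P)) 0 } := by
  obtain ⟨J, hJ, hPJ, htr⟩ := hch
  obtain ⟨F0, hF0, hF0t, hF0s⟩ := aux_slater hP hJ hPJ htr
  set D := { x : ℝ | ∃ T : Matrix B B ℂ, T.IsHermitian ∧ x = T.trace.re ∧
      ∃ F : Matrix (A × B) (A × B) ℂ, F.IsHermitian ∧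
        loe F ((1 : Matrix A A ℂ) ⊗ₖ T) ∧ trB F = 1 ∧
        loe ((1 - P) * F * (1 - P)) 0 } with hD
  unfold Upsilon
  set C := { x : ℝ | ∃ S : Matrix A A ℂ, S.IsHermitian ∧ x = S.trace.re ∧
    ∃ E : Matrix (A × B) (A × B) ℂ,
      loe 0 E ∧ loe E (S ⊗ₖ (1 : Matrix B B ℂ)) ∧ trA E = 1 ∧
      (P * (S ⊗ₖ (1 : Matrix B B ℂ) - E)).trace = 0 } with hC
  have weak : ∀ x ∈ C, ∀ y ∈ D, x ≤ y := by
    rintro _ ⟨S, hS, rfl, E, h1, h2, h3, h4⟩ _ ⟨T, hT, rfl, F, hF, h5, h6, h7⟩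
    exact aux_weak hP h1 h2 h3 h4 h5 h6 h7
  have hDne : D.Nonempty := by
    obtain ⟨c, _, hc⟩ := aux_le_norm F0 hF0
    refine ⟨_, c • (1 : Matrix B B ℂ), ?_, rfl, F0, hF0, ?_, hF0t, ?_⟩
    · show (_)ᴴ = _
      simp [Matrix.conjTranspose_smul]
    · unfold loe
      rwa [Matrix.kronecker_smul, Matrix.one_kronecker_one]
    · unfold loe
      have hQ : (1 - P : Matrix (A × B) (A × B) ℂ).IsHermitian := Matrix.isHermitian_one.sub hP.1
      have a3 : (1 - P) * (1 - P) = 1 - P := by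
        rw [Matrix.sub_mul, Matrix.mul_sub, Matrix.mul_sub, hP.2]; simp
      have := Matrix.posSemidef_conjTranspose_mul_self (1 - P)
      rw [hQ.eq, a3] at this
      rwa [hF0s, zero_sub, neg_neg]
  have hCne : C.Nonempty := by
    have hA : (Fintype.card A : ℂ) ≠ 0 := by simp
    have hk : ((Fintype.card A : ℝ)⁻¹ • (1 : Matrix A A ℂ)) ⊗ₖ (1 : Matrix B B ℂ)
        = (Fintype.card A : ℝ)⁻¹ • (1 : Matrix (A × B) (A × B) ℂ) := by
      rw [Matrix.smul_kronecker, Matrix.one_kronecker_one]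
    refine ⟨_, (Fintype.card A : ℝ)⁻¹ • (1 : Matrix A A ℂ), ?_, rfl,
      (Fintype.card A : ℝ)⁻¹ • (1 : Matrix (A × B) (A × B) ℂ), ?_, ?_, ?_, ?_⟩
    · show (_)ᴴ = _
      simp [Matrix.conjTranspose_smul]
    · unfold loe
      rw [sub_zero]
      exact aux_smul (by positivity) Matrix.PosSemidef.one
    · unfold loe
      rw [hk, sub_self]; exact Matrix.PosSemidef.zero
    · ext i j
      by_cases hij : i = j
      · subst hij
        simp [trA]
      · simp [trA, hij, Matrix.one_apply]
    · rw [hk, sub_self]; simp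
  have hDbdd : BddBelow D := by
    obtain ⟨x, hx⟩ := hCne
    exact ⟨x, fun y hy => weak x hx y hy⟩
  have hCbdd : BddAbove C := by
    obtain ⟨y, hy⟩ := hDne
    exact ⟨y, fun x hx => weak x hx y hy⟩
  apply le_antisymm
  · exact csSup_le hCne fun x hx => le_csInf hDne fun y hy => weak x hx y hy
  · obtain ⟨S, hS, hd, hrest⟩ := aux_strong P hP (sInf D)
      (fun T F hT hF h1 h2 h3 => csInf_le hDbdd ⟨T, hT, rfl, F, hF, h1, h2, h3⟩) F0 hF0 hF0t hF0s
    exact hd.trans (le_csSup hCbdd ⟨S, hS, rfl, hrest⟩)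
end
end

section
/- Let A and B be nonempty finite types and let P be a projection on ℂ^(A×B) such that Tr_B(P) is positive definite. Then the semidefinite packing number satisfies A(P) = inf { Re(trace T) : T a positive semidefinite B×B matrix with Tr_B(P·(1_A ⊗ T)) ≥ 1_A }. (Strong duality between the primal and dual forms of the semidefinite packing number.) -/
open Matrix Kronecker BigOperators
open scoped ComplexOrder

noncomputable section

variable {A B : Type*} [Fintype A] [Fintype B] [DecidableEq A] [DecidableEq B]

/-- Semidefinite packing number (primal SDP). -/
def Aram (P : Matrix (A × B) (A × B) ℂ) : ℝ :=
  sSup { x : ℝ | ∃ S : Matrix A A ℂ, S.PosSemidef ∧ x = S.trace.re ∧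
    loe (trA (P * (S ⊗ₖ (1 : Matrix B B ℂ)))) 1 }

lemma psd_factor {n : Type*} [Fintype n] [DecidableEq n] {S : Matrix n n ℂ} (hS : S.PosSemidef) :
    ∃ L : Matrix n n ℂ, S = Lᴴ * L := by
  open scoped MatrixOrder Matrix.Norms.L2Operator in
  exact CStarAlgebra.nonneg_iff_eq_star_mul_self.mp hS.nonneg

lemma psd_trace_mul {n : Type*} [Fintype n] [DecidableEq n] {S T : Matrix n n ℂ}
    (hS : S.PosSemidef) (hT : T.PosSemidef) : 0 ≤ (S * T).trace.re := by
  obtain ⟨L, rfl⟩ := psd_factor hS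
  rw [Matrix.mul_assoc, Matrix.trace_mul_comm]
  exact (Complex.le_def.mp (hT.mul_mul_conjTranspose_same L).trace_nonneg).1

lemma psd_of_re {n : Type*} [Fintype n] {H : Matrix n n ℂ} (hH : H.IsHermitian)
    (h : ∀ x : n → ℂ, 0 ≤ (star x ⬝ᵥ (H *ᵥ x)).re) : H.PosSemidef := by
  refine Matrix.PosSemidef.of_dotProduct_mulVec_nonneg hH fun x => ?_
  rw [Complex.le_def]
  refine ⟨h x, ?_⟩
  have := hH.im_star_dotProduct_mulVec_self x
  simpa using this.symm

lemma psd_of_trace {n : Type*} [Fintype n] [DecidableEq n] {H : Matrix n n ℂ}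
    (hH : H.IsHermitian)
    (h : ∀ S : Matrix n n ℂ, S.PosSemidef → 0 ≤ (H * S).trace.re) : H.PosSemidef := by
  refine psd_of_re hH fun x => ?_
  have := h _ (Matrix.posSemidef_vecMulVec_self_star x)
  rwa [Matrix.mul_vecMulVec, Matrix.trace_vecMulVec, dotProduct_comm] at this

lemma psd_closed {n : Type*} [Fintype n] : IsClosed {Q : Matrix n n ℂ | Q.PosSemidef} := by
  have : {Q : Matrix n n ℂ | Q.PosSemidef} = {Q : Matrix n n ℂ | Qᴴ = Q} ∩
      ⋂ x : n → ℂ, {Q | 0 ≤ (star x ⬝ᵥ (Q *ᵥ x)).re} := by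
    ext Q
    simp only [Set.mem_setOf_eq, Set.mem_inter_iff, Set.mem_iInter]
    exact ⟨fun h => ⟨h.1, fun x => h.re_dotProduct_nonneg x⟩, fun h => psd_of_re h.1 h.2⟩
  rw [this]
  refine (isClosed_eq (by fun_prop) (by fun_prop)).inter (isClosed_iInter fun x => ?_)
  refine isClosed_le continuous_const (Complex.continuous_re.comp ?_)
  fun_prop

lemma dens_compact {n : Type*} [Fintype n] [DecidableEq n] :
    IsCompact {S : Matrix n n ℂ | S.PosSemidef ∧ S.trace.re = 1} := by
  have key : ∀ L : Matrix n n ℂ, (Lᴴ * L).trace.re = ∑ i, ∑ k, ‖L k i‖ ^ 2 := by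
    intro L
    simp [Matrix.trace, Matrix.mul_apply, ← Complex.normSq_eq_norm_sq, Complex.normSq_apply]
  have : {S : Matrix n n ℂ | S.PosSemidef ∧ S.trace.re = 1} =
      (fun L : Matrix n n ℂ => Lᴴ * L) '' {L | (Lᴴ * L).trace.re = 1} := by
    ext S
    constructor
    · rintro ⟨h, h1⟩
      obtain ⟨L, rfl⟩ := psd_factor h
      exact ⟨L, h1, rfl⟩
    · rintro ⟨L, h1, rfl⟩
      exact ⟨Matrix.posSemidef_conjTranspose_mul_self L, h1⟩
  rw [this]
  refine IsCompact.image ?_ (by fun_prop)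
  have hc : IsCompact (Set.univ.pi fun _ : n => Set.univ.pi fun _ : n =>
      Metric.closedBall (0 : ℂ) 1) :=
    isCompact_univ_pi fun _ => isCompact_univ_pi fun _ => isCompact_closedBall _ _
  refine IsCompact.of_isClosed_subset hc (isClosed_eq ?_ continuous_const) ?_
  · exact Complex.continuous_re.comp (by fun_prop)
  · intro L hL k _ i _
    rw [Set.mem_setOf_eq, key] at hL
    rw [mem_closedBall_zero_iff]
    have h1 : ‖L k i‖ ^ 2 ≤ ∑ k, ‖L k i‖ ^ 2 :=
      Finset.single_le_sum (f := fun k => ‖L k i‖ ^ 2) (fun _ _ => by positivity)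
        (Finset.mem_univ k)
    have h2 : ∑ k, ‖L k i‖ ^ 2 ≤ ∑ i, ∑ k, ‖L k i‖ ^ 2 :=
      Finset.single_le_sum (f := fun i => ∑ k, ‖L k i‖ ^ 2) (fun _ _ => by positivity)
        (Finset.mem_univ i)
    nlinarith [norm_nonneg (L k i)]

lemma dual_rep {n : Type*} [Fintype n] [DecidableEq n] (g : Matrix n n ℂ →ₗ[ℝ] ℝ) :
    ∃ T : Matrix n n ℂ, T.IsHermitian ∧
      ∀ Q : Matrix n n ℂ, Q.IsHermitian → g Q = (T * Q).trace.re := by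
  let T0 : Matrix n n ℂ := Matrix.of fun j i =>
    (g (Matrix.single i j 1) : ℂ) - Complex.I * (g (Matrix.single i j Complex.I) : ℂ)
  have h0 : ∀ Q : Matrix n n ℂ, g Q = (T0 * Q).trace.re := by
    intro Q
    have hs : ∀ i j, g (Matrix.single i j (Q i j)) = (T0 j i * Q i j).re := by
      intro i j
      have : Matrix.single i j (Q i j) = (Q i j).re • Matrix.single i j (1 : ℂ)
          + (Q i j).im • Matrix.single i j Complex.I := by
        rw [Matrix.smul_single, Matrix.smul_single, ← Matrix.single_add]
        congr 1
        simp
      rw [this, map_add, map_smul, map_smul]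
      simp [T0]
      ring
    conv_lhs => rw [Matrix.matrix_eq_sum_single Q]
    simp only [map_sum, hs, Matrix.trace, Matrix.diag, Matrix.mul_apply, Complex.re_sum]
    rw [Finset.sum_comm]
  refine ⟨(2⁻¹ : ℝ) • (T0 + T0ᴴ), ?_, fun Q hQ => ?_⟩
  · unfold Matrix.IsHermitian
    rw [Matrix.conjTranspose_smul, Matrix.conjTranspose_add, Matrix.conjTranspose_conjTranspose,
      add_comm, star_trivial]
  · have h2 : (T0ᴴ * Q).trace.re = (T0 * Q).trace.re := by
      have : T0ᴴ * Q = (Q * T0)ᴴ := by rw [Matrix.conjTranspose_mul, hQ.eq]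
      rw [this, Matrix.trace_conjTranspose, Matrix.trace_mul_comm]
      simp
    rw [Matrix.smul_mul, Matrix.trace_smul, Matrix.add_mul, Matrix.trace_add, Complex.smul_re,
      Complex.add_re, h2, h0]
    simp only [smul_eq_mul]
    ring

lemma trA_apply' (P : Matrix (A × B) (A × B) ℂ) (S : Matrix A A ℂ) (b b' : B) :
    trA (P * (S ⊗ₖ (1 : Matrix B B ℂ))) b b' = ∑ a, ∑ a', P (a, b) (a', b') * S a' a := by
  simp [trA, Matrix.mul_apply, Fintype.sum_prod_type, Matrix.kroneckerMap_apply, Matrix.one_apply]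

lemma trB_apply' (P : Matrix (A × B) (A × B) ℂ) (T : Matrix B B ℂ) (a a' : A) :
    trB (P * ((1 : Matrix A A ℂ) ⊗ₖ T)) a a' = ∑ b, ∑ b', P (a, b) (a', b') * T b' b := by
  simp only [trB, Matrix.of_apply, Matrix.mul_apply, Fintype.sum_prod_type,
    Matrix.kroneckerMap_apply, Matrix.one_apply]
  refine Finset.sum_congr rfl fun b _ => ?_
  rw [Finset.sum_comm]
  simp

lemma tr_adj (P : Matrix (A × B) (A × B) ℂ) (S : Matrix A A ℂ) (T : Matrix B B ℂ) :
    (trB (P * ((1 : Matrix A A ℂ) ⊗ₖ T)) * S).trace =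
      (T * trA (P * (S ⊗ₖ (1 : Matrix B B ℂ)))).trace := by
  rw [Matrix.trace_mul_comm T]
  simp only [Matrix.trace, Matrix.diag, Matrix.mul_apply, trA_apply', trB_apply', Finset.sum_mul]
  have e1 : ∀ F : A → A → B → B → ℂ, ∑ a, ∑ a', ∑ b, ∑ b', F a a' b b'
      = ∑ b, ∑ b', ∑ a, ∑ a', F a a' b b' := by
    intro F
    calc _ = ∑ a, ∑ b, ∑ a', ∑ b', F a a' b b' :=
          Finset.sum_congr rfl fun a _ => Finset.sum_comm
      _ = ∑ b, ∑ a, ∑ a', ∑ b', F a a' b b' := Finset.sum_comm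
      _ = ∑ b, ∑ a, ∑ b', ∑ a', F a a' b b' :=
          Finset.sum_congr rfl fun b _ => Finset.sum_congr rfl fun a _ => Finset.sum_comm
      _ = _ := Finset.sum_congr rfl fun b _ => Finset.sum_comm
  rw [e1]
  refine Finset.sum_congr rfl fun b _ => Finset.sum_congr rfl fun b' _ =>
    Finset.sum_congr rfl fun a _ => Finset.sum_congr rfl fun a' _ => by ring

lemma trB_herm_s2 (P : Matrix (A × B) (A × B) ℂ) (hP : P.IsHermitian) (T : Matrix B B ℂ)
    (hT : T.IsHermitian) : (trB (P * ((1 : Matrix A A ℂ) ⊗ₖ T))).IsHermitian := by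
  ext a a'
  rw [Matrix.conjTranspose_apply, trB_apply', trB_apply']
  simp only [star_sum, star_mul', hP.apply, hT.apply]
  rw [Finset.sum_comm]

/-- `trA (P (S ⊗ 1))` as a real-linear map. -/
def phiL (P : Matrix (A × B) (A × B) ℂ) : Matrix A A ℂ →ₗ[ℝ] Matrix B B ℂ where
  toFun S := trA (P * (S ⊗ₖ (1 : Matrix B B ℂ)))
  map_add' S S' := by
    ext b b'
    simp [trA_apply', mul_add, Finset.sum_add_distrib]
  map_smul' c S := by
    ext b b'
    simp [trA_apply', Finset.mul_sum, mul_left_comm]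

lemma phiL_apply (P : Matrix (A × B) (A × B) ℂ) (S : Matrix A A ℂ) :
    phiL P S = trA (P * (S ⊗ₖ (1 : Matrix B B ℂ))) := rfl

lemma phiL_cont (P : Matrix (A × B) (A × B) ℂ) : Continuous (phiL P) := by
  refine continuous_pi fun b => continuous_pi fun b' => ?_
  simp only [phiL_apply, trA_apply']
  fun_prop

lemma phiL_herm (P : Matrix (A × B) (A × B) ℂ) (hP : P.IsHermitian) (S : Matrix A A ℂ)
    (hS : S.IsHermitian) : (phiL P S).IsHermitian := by
  ext b b'
  rw [Matrix.conjTranspose_apply, phiL_apply, trA_apply', trA_apply']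
  simp only [star_sum, star_mul', hP.apply, hS.apply]
  rw [Finset.sum_comm]

lemma posdef_lower {n : Type*} [Fintype n] [DecidableEq n] {M : Matrix n n ℂ} (hM : M.PosDef) :
    ∃ c : ℝ, 0 < c ∧ (M - c • (1 : Matrix n n ℂ)).PosSemidef := by
  rcases isEmpty_or_nonempty n with h | h
  · exact ⟨1, one_pos, by convert Matrix.PosSemidef.zero; ext i; exact h.elim i⟩
  open scoped MatrixOrder Matrix.Norms.L2Operator in
  obtain ⟨c, hc, h⟩ := (CFC.exists_pos_algebraMap_le_iff hM.1.isSelfAdjoint).2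
    fun x hx => hM.isStrictlyPositive.spectrum_pos hx
  refine ⟨c, hc, ?_⟩
  rw [← Algebra.algebraMap_eq_smul_one]
  exact h

/-- weak duality -/
lemma weak_dual (P : Matrix (A × B) (A × B) ℂ) {S : Matrix A A ℂ} {T : Matrix B B ℂ}
    (hS : S.PosSemidef) (hT : T.PosSemidef)
    (h1 : loe (trA (P * (S ⊗ₖ (1 : Matrix B B ℂ)))) 1)
    (h2 : loe 1 (trB (P * ((1 : Matrix A A ℂ) ⊗ₖ T)))) : S.trace.re ≤ T.trace.re := by
  have a1 := psd_trace_mul hT h1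
  have a2 := psd_trace_mul h2 hS
  rw [Matrix.mul_sub, Matrix.trace_sub, Complex.sub_re, Matrix.mul_one] at a1
  rw [Matrix.sub_mul, Matrix.trace_sub, Complex.sub_re, Matrix.one_mul, tr_adj] at a2
  linarith

lemma strong_step (P : Matrix (A × B) (A × B) ℂ) (hP : P.IsHermitian) [Nonempty A] (γ : ℝ)
    (hγ : 0 < γ)
    (hα : ∀ S : Matrix A A ℂ, S.PosSemidef → loe (trA (P * (S ⊗ₖ (1 : Matrix B B ℂ)))) 1 →
      S.trace.re < γ) :
    ∃ T : Matrix B B ℂ, T.PosSemidef ∧ T.trace.re ≤ γ ∧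
      loe 1 (trB (P * ((1 : Matrix A A ℂ) ⊗ₖ T))) := by
  let D : Set (Matrix A A ℂ) := {S | S.PosSemidef ∧ S.trace.re = 1}
  let Q2 : Set (Matrix B B ℂ) := {Y | (γ⁻¹ • (1 : Matrix B B ℂ) - Y).PosSemidef}
  have hDc : Convex ℝ D := by
    intro S hS S' hS' a b ha hb hab
    refine ⟨(hS.1.smul ha).add (hS'.1.smul hb), ?_⟩
    rw [Matrix.trace_add, Matrix.trace_smul, Matrix.trace_smul, Complex.add_re, Complex.smul_re,
      Complex.smul_re, hS.2, hS'.2]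
    simpa using hab
  have hQc : Convex ℝ Q2 := by
    intro S hS S' hS' a b ha hb hab
    have := (hS.smul ha).add (hS'.smul hb)
    have e : a • (γ⁻¹ • (1 : Matrix B B ℂ) - S) + b • (γ⁻¹ • (1 : Matrix B B ℂ) - S')
        = γ⁻¹ • (1 : Matrix B B ℂ) - (a • S + b • S') := by
      obtain rfl : b = 1 - a := by linarith
      module
    rw [e] at this
    exact this
  have hQcl : IsClosed Q2 := psd_closed.preimage (by fun_prop)
  have hdisj : Disjoint (phiL P '' D) Q2 := by
    rw [Set.disjoint_left]
    rintro _ ⟨S, hS, rfl⟩ hq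
    have h1 := hα (γ • S) (hS.1.smul hγ.le) (by
      unfold loe
      rw [← phiL_apply, map_smul]
      have := Matrix.PosSemidef.smul hq hγ.le
      rwa [smul_sub, smul_smul, mul_inv_cancel₀ hγ.ne', one_smul] at this)
    rw [Matrix.trace_smul, Complex.smul_re, hS.2] at h1
    simp at h1
  haveI : LocallyConvexSpace ℝ (Matrix B B ℂ) :=
    inferInstanceAs (LocallyConvexSpace ℝ (B → B → ℂ))
  obtain ⟨f, u, v, hu, huv, hv⟩ := geometric_hahn_banach_compact_closed
    (hDc.linear_image (phiL P)) (dens_compact.image (phiL_cont P)) hQc hQcl hdisj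
  obtain ⟨T, hTh, hT⟩ := dual_rep (-(f : Matrix B B ℂ →ₗ[ℝ] ℝ))
  simp only [LinearMap.neg_apply, ContinuousLinearMap.coe_coe] at hT
  have hone : f (1 : Matrix B B ℂ) = -T.trace.re := by
    have := hT 1 Matrix.isHermitian_one
    rw [Matrix.mul_one] at this
    linarith
  have hTpsd : T.PosSemidef := by
    refine psd_of_trace hTh fun Q hQ => ?_
    rw [← hT Q hQ.1]
    by_contra hneg
    push Not at hneg
    have hpos : 0 < f Q := by linarith
    obtain ⟨k, hk⟩ := exists_nat_gt ((f (γ⁻¹ • (1 : Matrix B B ℂ)) - v) / f Q)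
    have h1 := hv (γ⁻¹ • (1 : Matrix B B ℂ) - (k : ℝ) • Q) (by
      change (γ⁻¹ • (1 : Matrix B B ℂ) - (γ⁻¹ • (1 : Matrix B B ℂ) - (k : ℝ) • Q)).PosSemidef
      rw [sub_sub_cancel]
      exact hQ.smul (Nat.cast_nonneg k))
    rw [map_sub, map_smul f (k : ℝ) Q, smul_eq_mul] at h1
    rw [div_lt_iff₀ hpos] at hk
    linarith
  have hTtr : 0 ≤ T.trace.re := (Complex.le_def.mp hTpsd.trace_nonneg).1
  have hβ : γ⁻¹ * T.trace.re < -v := by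
    have h1 := hv (γ⁻¹ • (1 : Matrix B B ℂ)) (by
      change (γ⁻¹ • (1 : Matrix B B ℂ) - γ⁻¹ • (1 : Matrix B B ℂ)).PosSemidef
      rw [sub_self]
      exact Matrix.PosSemidef.zero)
    rw [map_smul, hone, smul_eq_mul] at h1
    linarith
  have hγ' : 0 < γ⁻¹ := inv_pos.mpr hγ
  have hw : 0 < -u := by
    have := mul_nonneg hγ'.le hTtr
    linarith
  have hD : ∀ S ∈ D, -u < (T * phiL P S).trace.re := by
    intro S hS
    rw [← hT _ (phiL_herm P hP S hS.1.1)]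
    have := hu _ ⟨S, hS, rfl⟩
    linarith
  have hall : ∀ S : Matrix A A ℂ, S.PosSemidef → -u * S.trace.re ≤ (T * phiL P S).trace.re := by
    intro S hS
    have hs0 := Complex.le_def.mp hS.trace_nonneg
    rcases hs0.1.eq_or_lt with h | h
    · have : S.trace = 0 := Complex.ext (by simpa using h.symm) (by simpa using hs0.2.symm)
      rw [hS.trace_eq_zero_iff] at this
      simp [this]
    · simp only [Complex.zero_re] at h
      have h1 := hD ((S.trace.re)⁻¹ • S) ⟨hS.smul (inv_nonneg.mpr h.le), by
        rw [Matrix.trace_smul, Complex.smul_re, smul_eq_mul, inv_mul_cancel₀ h.ne']⟩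
      rw [map_smul, Matrix.mul_smul, Matrix.trace_smul, Complex.smul_re, smul_eq_mul,
        inv_mul_eq_div, lt_div_iff₀ h] at h1
      exact h1.le
  have hT' : ((-u)⁻¹ • T).PosSemidef := hTpsd.smul (inv_nonneg.mpr hw.le)
  refine ⟨(-u)⁻¹ • T, hT', ?_, ?_⟩
  · rw [Matrix.trace_smul, Complex.smul_re, smul_eq_mul, inv_mul_eq_div, div_le_iff₀ hw]
    have : γ⁻¹ * T.trace.re < -u := by linarith
    rw [inv_mul_eq_div, div_lt_iff₀ hγ] at this
    linarith
  · refine psd_of_trace ((trB_herm_s2 P hP _ hT'.1).sub Matrix.isHermitian_one) fun S hS => ?_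
    rw [Matrix.sub_mul, Matrix.trace_sub, tr_adj, Matrix.one_mul, ← phiL_apply, Matrix.smul_mul,
      Matrix.trace_smul, Complex.sub_re, Complex.smul_re, smul_eq_mul, inv_mul_eq_div, sub_nonneg,
      le_div_iff₀ hw]
    linarith [hall S hS]

/-- Strong duality for the semidefinite packing number. -/
theorem aram_strong_duality [Nonempty A] [Nonempty B]
    (P : Matrix (A × B) (A × B) ℂ) (hP : IsProj P) (hPD : (trB P).PosDef) :
    Aram P = sInf { x : ℝ | ∃ T : Matrix B B ℂ, T.PosSemidef ∧ x = T.trace.re ∧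
      loe 1 (trB (P * ((1 : Matrix A A ℂ) ⊗ₖ T))) } := by
  have hprim : Set.Nonempty { x : ℝ | ∃ S : Matrix A A ℂ, S.PosSemidef ∧ x = S.trace.re ∧
      loe (trA (P * (S ⊗ₖ (1 : Matrix B B ℂ)))) 1 } := by
    refine ⟨0, 0, Matrix.PosSemidef.zero, by simp, ?_⟩
    unfold loe
    rw [← phiL_apply, map_zero, sub_zero]
    exact Matrix.PosSemidef.one
  have h0 : ∃ x ∈ { x : ℝ | ∃ S : Matrix A A ℂ, S.PosSemidef ∧ x = S.trace.re ∧
      loe (trA (P * (S ⊗ₖ (1 : Matrix B B ℂ)))) 1 }, 0 ≤ x := by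
    obtain ⟨x, S, hS, hx, h⟩ := hprim
    exact ⟨x, ⟨S, hS, hx, h⟩, hx ▸ (Complex.le_def.mp hS.trace_nonneg).1⟩
  have hdual : Set.Nonempty { x : ℝ | ∃ T : Matrix B B ℂ, T.PosSemidef ∧ x = T.trace.re ∧
      loe 1 (trB (P * ((1 : Matrix A A ℂ) ⊗ₖ T))) } := by
    obtain ⟨c, hc, h⟩ := posdef_lower hPD
    refine ⟨_, c⁻¹ • (1 : Matrix B B ℂ), Matrix.PosSemidef.one.smul (inv_nonneg.mpr hc.le),
      rfl, ?_⟩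
    have h' := h.smul (inv_nonneg.mpr hc.le)
    rw [smul_sub, smul_smul, inv_mul_cancel₀ hc.ne', one_smul] at h'
    unfold loe
    rw [Matrix.kronecker_smul, Matrix.one_kronecker_one, Matrix.mul_smul, Matrix.mul_one]
    have : trB (c⁻¹ • P) = c⁻¹ • trB P := by
      ext a a'
      simp [trB, Finset.mul_sum]
    rwa [this]
  have hweak : ∀ x ∈ { x : ℝ | ∃ S : Matrix A A ℂ, S.PosSemidef ∧ x = S.trace.re ∧
      loe (trA (P * (S ⊗ₖ (1 : Matrix B B ℂ)))) 1 }, ∀ y ∈ { x : ℝ | ∃ T : Matrix B B ℂ,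
      T.PosSemidef ∧ x = T.trace.re ∧ loe 1 (trB (P * ((1 : Matrix A A ℂ) ⊗ₖ T))) }, x ≤ y := by
    rintro x ⟨S, hS, rfl, h1⟩ y ⟨T, hT, rfl, h2⟩
    exact weak_dual P hS hT h1 h2
  obtain ⟨y0, hy0⟩ := hdual
  obtain ⟨x0, hx0, hx0'⟩ := h0
  have hbdd : BddAbove { x : ℝ | ∃ S : Matrix A A ℂ, S.PosSemidef ∧ x = S.trace.re ∧
      loe (trA (P * (S ⊗ₖ (1 : Matrix B B ℂ)))) 1 } := ⟨y0, fun x hx => hweak x hx y0 hy0⟩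
  have hbdd' : BddBelow { x : ℝ | ∃ T : Matrix B B ℂ,
      T.PosSemidef ∧ x = T.trace.re ∧ loe 1 (trB (P * ((1 : Matrix A A ℂ) ⊗ₖ T))) } :=
    ⟨x0, fun y hy => hweak x0 hx0 y hy⟩
  unfold Aram
  apply le_antisymm
  · exact csSup_le hprim fun x hx => le_csInf ⟨y0, hy0⟩ fun y hy => hweak x hx y hy
  · refine le_of_forall_pos_le_add fun ε hε => ?_
    have hα0 := hx0'.trans (le_csSup hbdd hx0)
    obtain ⟨T, hT, hle, hf⟩ := strong_step P hP.1 _ (add_pos_of_nonneg_of_pos hα0 hε)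
      (fun S hS h => lt_of_le_of_lt (le_csSup hbdd ⟨S, hS, rfl, h⟩) (lt_add_of_pos_right _ hε))
    exact (csInf_le hbdd' ⟨T, hT, rfl, hf⟩).trans hle
end
end

section
/- Let A₁, B₁, A₂, B₂ be nonempty finite types and let P₁ be a projection on ℂ^(A₁×B₁) and P₂ a projection on ℂ^(A₂×B₂). Then the no-signalling assisted independence number is super-multiplicative: Υ(P₁ ⊠ P₂) ≥ Υ(P₁) · Υ(P₂). -/
open Matrix Kronecker BigOperators
open scoped ComplexOrder

noncomputable section

variable {A B : Type*} [Fintype A] [Fintype B] [DecidableEq A] [DecidableEq B]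

/-- Tensor product of non-commutative bipartite graphs (projections). -/
def boxProd {A₁ B₁ A₂ B₂ : Type*}
    (P₁ : Matrix (A₁ × B₁) (A₁ × B₁) ℂ) (P₂ : Matrix (A₂ × B₂) (A₂ × B₂) ℂ) :
    Matrix ((A₁ × A₂) × (B₁ × B₂)) ((A₁ × A₂) × (B₁ × B₂)) ℂ :=
  Matrix.of fun x y =>
    P₁ (x.1.1, x.2.1) (y.1.1, y.2.1) * P₂ (x.1.2, x.2.2) (y.1.2, y.2.2)

theorem aux_psd_trace_ge {n : Type*} [Fintype n] [DecidableEq n] {T : Matrix n n ℂ}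
    (hT : T.PosDef) : ∃ c : ℝ, 0 < c ∧ ∀ S : Matrix n n ℂ, S.PosSemidef →
      c * S.trace.re ≤ (T * S).trace.re := by
  classical
  have hH := hT.isHermitian
  have hc : ∃ c : ℝ, 0 < c ∧ ∀ i, c ≤ hH.eigenvalues i := by
    rcases isEmpty_or_nonempty n with h | h
    · exact ⟨1, one_pos, fun i => (h.false i).elim⟩
    · obtain ⟨i, hi⟩ := Finite.exists_min hH.eigenvalues
      exact ⟨_, hT.eigenvalues_pos i, hi⟩
  obtain ⟨c, hc0, hc⟩ := hc
  refine ⟨c, hc0, fun S hS => ?_⟩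
  set U : Matrix n n ℂ := (hH.eigenvectorUnitary : Matrix n n ℂ) with hU
  have hUU : U * Uᴴ = 1 := by
    have := Unitary.coe_mul_star_self hH.eigenvectorUnitary
    simpa [star_eq_conjTranspose] using this
  have hsp : T = U * diagonal (RCLike.ofReal ∘ hH.eigenvalues) * Uᴴ := by
    have := hH.spectral_theorem
    rw [Unitary.conjStarAlgAut_apply] at this
    simpa [star_eq_conjTranspose] using this
  have hM := hS.conjTranspose_mul_mul_same U
  have h1 : (T * S).trace = (diagonal (RCLike.ofReal ∘ hH.eigenvalues) * (Uᴴ * S * U)).trace := by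
    conv_lhs => rw [hsp]
    rw [Matrix.mul_assoc, Matrix.mul_assoc, Matrix.trace_mul_comm]
    simp only [Matrix.mul_assoc]
  have h2 : S.trace = (Uᴴ * S * U).trace := by
    rw [Matrix.trace_mul_comm, ← Matrix.mul_assoc, hUU, Matrix.one_mul]
  rw [h1, h2]
  simp only [Matrix.trace, Matrix.diag_apply, Matrix.diagonal_mul, Complex.re_sum, Finset.mul_sum]
  refine Finset.sum_le_sum fun i _ => ?_
  have hi : 0 ≤ ((Uᴴ * S * U) i i).re := (Complex.le_def.1 (hM.diag_nonneg (i := i))).1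
  simpa using mul_le_mul_of_nonneg_right (hc i) hi

theorem aux_trace_kron_one (P : Matrix (A × B) (A × B) ℂ) (S : Matrix A A ℂ) :
    (P * (S ⊗ₖ (1 : Matrix B B ℂ))).trace = (trB P * S).trace := by
  simp only [Matrix.trace, Matrix.diag_apply, Matrix.mul_apply, Fintype.sum_prod_type, trB,
    Matrix.of_apply, kroneckerMap_apply, Matrix.one_apply, mul_ite, mul_one, mul_zero,
    Finset.sum_ite_eq', Finset.mem_univ, if_true, Finset.sum_mul]
  refine Finset.sum_congr rfl fun a _ => ?_
  rw [Finset.sum_comm]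

theorem aux_psd_of_kron [Nonempty B] {S : Matrix A A ℂ}
    (h : (S ⊗ₖ (1 : Matrix B B ℂ)).PosSemidef) : S.PosSemidef := by
  obtain ⟨b⟩ := ‹Nonempty B›
  have := h.submatrix (fun a => (a, b))
  convert this using 1
  ext a a'
  simp

theorem aux_trace_trA (E : Matrix (A × B) (A × B) ℂ) : E.trace = (trA E).trace := by
  simp only [Matrix.trace, Matrix.diag_apply, Fintype.sum_prod_type, trA, Matrix.of_apply]
  rw [Finset.sum_comm]

theorem aux_proj_trace_le {n : Type*} [Fintype n] [DecidableEq n] {P E : Matrix n n ℂ}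
    (hP : IsProj P) (hE : E.PosSemidef) : (P * E).trace.re ≤ E.trace.re := by
  have h1 : (1 - P) * (1 - P) = 1 - P := by
    rw [Matrix.sub_mul, Matrix.mul_sub, Matrix.mul_sub, hP.2]; simp
  have h2 : (1 - P)ᴴ = 1 - P := by
    rw [conjTranspose_sub, hP.1.eq, conjTranspose_one]
  have h3 := (hE.conjTranspose_mul_mul_same (1 - P)).trace_nonneg
  rw [h2, Matrix.trace_mul_comm, ← Matrix.mul_assoc, h1, Matrix.sub_mul, Matrix.one_mul,
    Matrix.trace_sub] at h3
  have := (Complex.le_def.1 h3).1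
  simp at this
  linarith

/-- The feasible set. -/
def feas (P : Matrix (A × B) (A × B) ℂ) : Set ℝ :=
  { x : ℝ | ∃ S : Matrix A A ℂ, S.IsHermitian ∧ x = S.trace.re ∧
    ∃ E : Matrix (A × B) (A × B) ℂ,
      loe 0 E ∧ loe E (S ⊗ₖ (1 : Matrix B B ℂ)) ∧ trA E = 1 ∧
      (P * (S ⊗ₖ (1 : Matrix B B ℂ) - E)).trace = 0 }

theorem upsilon_eq (P : Matrix (A × B) (A × B) ℂ) : Upsilon P = sSup (feas P) := rfl

theorem aux_S_psd [Nonempty B] {S : Matrix A A ℂ} {E : Matrix (A × B) (A × B) ℂ}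
    (h0 : loe 0 E) (h1 : loe E (S ⊗ₖ (1 : Matrix B B ℂ))) : S.PosSemidef := by
  unfold loe at h0 h1
  rw [sub_zero] at h0
  apply aux_psd_of_kron (B := B)
  simpa using h1.add h0

theorem feas_nonneg [Nonempty B] {P : Matrix (A × B) (A × B) ℂ} {x : ℝ} (hx : x ∈ feas P) :
    0 ≤ x := by
  obtain ⟨S, hS, rfl, E, h0, h1, h2, h3⟩ := hx
  exact (Complex.le_def.1 (aux_S_psd h0 h1).trace_nonneg).1

theorem feas_bdd [Nonempty B] {P : Matrix (A × B) (A × B) ℂ} (hP : IsProj P)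
    (hT : (trB P).PosDef) : BddAbove (feas P) := by
  obtain ⟨c, hc, h⟩ := aux_psd_trace_ge hT
  refine ⟨(Fintype.card B : ℝ) / c, ?_⟩
  rintro x ⟨S, hS, rfl, E, h0, h1, h2, h3⟩
  have a := h S (aux_S_psd h0 h1)
  rw [← aux_trace_kron_one] at a
  rw [Matrix.mul_sub, Matrix.trace_sub, sub_eq_zero] at h3
  rw [h3] at a
  have h0' : E.PosSemidef := by simpa [loe] using h0
  have b := aux_proj_trace_le hP h0'
  rw [aux_trace_trA E, h2, Matrix.trace_one] at b
  simp at b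
  rw [le_div_iff₀ hc]
  linarith

theorem trB_psd {P : Matrix (A × B) (A × B) ℂ} (hP : IsProj P) : (trB P).PosSemidef := by
  have h : P.PosSemidef := by
    have := posSemidef_conjTranspose_mul_self P
    rwa [hP.1.eq, hP.2] at this
  have e : trB P = ∑ b, P.submatrix (fun a => (a, b)) (fun a => (a, b)) := by
    ext a a'
    simp [trB, Matrix.sum_apply]
  rw [e]
  exact posSemidef_sum _ fun b _ => h.submatrix _

theorem feas_unbdd [Nonempty A] {P : Matrix (A × B) (A × B) ℂ} (hP : IsProj P)
    (hT : ¬ (trB P).PosDef) : ¬ BddAbove (feas P) := by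
  have hps := trB_psd hP
  have hv : ∃ v : A → ℂ, v ≠ 0 ∧ star v ⬝ᵥ (trB P *ᵥ v) = 0 := by
    by_contra! hcon
    exact hT (PosDef.of_dotProduct_mulVec_pos hps.1 fun x hx =>
      lt_of_le_of_ne (hps.dotProduct_mulVec_nonneg x) (hcon x hx).symm)
  obtain ⟨v, hv0, hv⟩ := hv
  rintro ⟨M, hM⟩
  set V : Matrix A A ℂ := vecMulVec v (star v) with hV
  have hVp : V.PosSemidef := posSemidef_vecMulVec_self_star v
  have htr : 0 < V.trace.re := by
    rw [hV, Matrix.trace_vecMulVec, dotProduct_comm]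
    have : 0 < star v ⬝ᵥ v := dotProduct_star_self_pos_iff.2 hv0
    exact (Complex.lt_def.1 this).1
  have hTV : (trB P * V).trace = 0 := by
    rw [hV, Matrix.mul_vecMulVec, Matrix.trace_vecMulVec, dotProduct_comm, hv]
  have hcA : (Fintype.card A : ℂ) ≠ 0 := by exact_mod_cast Fintype.card_ne_zero
  set S0 : Matrix A A ℂ := ((Fintype.card A : ℝ)⁻¹ : ℝ) • (1 : Matrix A A ℂ) with hS0
  have hS0p : S0.PosSemidef := PosSemidef.one.smul (by positivity)
  have hmem : ∀ t : ℝ, 0 ≤ t → (S0 + t • V).trace.re ∈ feas P := by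
    intro t ht
    have htV : (t • V).PosSemidef := hVp.smul ht
    refine ⟨S0 + t • V, (hS0p.add htV).1, rfl, S0 ⊗ₖ (1 : Matrix B B ℂ), ?_, ?_, ?_, ?_⟩
    · simpa [loe] using hS0p.kronecker PosSemidef.one
    · unfold loe
      rw [add_kronecker, add_sub_cancel_left]
      exact htV.kronecker PosSemidef.one
    · ext b b'
      simp [trA, hS0, Matrix.one_apply, hcA]
    · rw [add_kronecker, add_sub_cancel_left, aux_trace_kron_one, Matrix.mul_smul,
        Matrix.trace_smul, hTV, smul_zero]
  have h1 := hM (hmem ((|M| + 1) / V.trace.re) (by positivity))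
  have h2 : 0 ≤ S0.trace.re := (Complex.le_def.1 hS0p.trace_nonneg).1
  rw [Matrix.trace_add, Matrix.trace_smul _ V, Complex.add_re, Complex.smul_re, smul_eq_mul,
    div_mul_cancel₀ _ htr.ne'] at h1
  linarith [le_abs_self M]

section prod

variable {A₁ B₁ A₂ B₂ : Type*} [Fintype A₁] [Fintype B₁] [Fintype A₂] [Fintype B₂]
    [DecidableEq A₁] [DecidableEq B₁] [DecidableEq A₂] [DecidableEq B₂]

theorem boxProd_eq (P₁ : Matrix (A₁ × B₁) (A₁ × B₁) ℂ) (P₂ : Matrix (A₂ × B₂) (A₂ × B₂) ℂ) :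
    boxProd P₁ P₂ = (P₁ ⊗ₖ P₂).submatrix (Equiv.prodProdProdComm A₁ A₂ B₁ B₂)
      (Equiv.prodProdProdComm A₁ A₂ B₁ B₂) := by
  ext x y
  simp [boxProd]

theorem boxProd_mul (P₁ Q₁ : Matrix (A₁ × B₁) (A₁ × B₁) ℂ)
    (P₂ Q₂ : Matrix (A₂ × B₂) (A₂ × B₂) ℂ) :
    boxProd P₁ P₂ * boxProd Q₁ Q₂ = boxProd (P₁ * Q₁) (P₂ * Q₂) := by
  rw [boxProd_eq, boxProd_eq, boxProd_eq, submatrix_mul_equiv, mul_kronecker_mul]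

theorem boxProd_trace (P₁ : Matrix (A₁ × B₁) (A₁ × B₁) ℂ)
    (P₂ : Matrix (A₂ × B₂) (A₂ × B₂) ℂ) :
    (boxProd P₁ P₂).trace = P₁.trace * P₂.trace := by
  rw [← trace_kronecker, boxProd_eq]
  simp only [Matrix.trace, Matrix.diag_apply, submatrix_apply]
  exact Equiv.sum_comp (Equiv.prodProdProdComm A₁ A₂ B₁ B₂) (fun i => (P₁ ⊗ₖ P₂) i i)

theorem boxProd_psd {P₁ : Matrix (A₁ × B₁) (A₁ × B₁) ℂ} {P₂ : Matrix (A₂ × B₂) (A₂ × B₂) ℂ}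
    (h₁ : P₁.PosSemidef) (h₂ : P₂.PosSemidef) : (boxProd P₁ P₂).PosSemidef := by
  rw [boxProd_eq]
  exact (h₁.kronecker h₂).submatrix _

theorem boxProd_kron (S₁ : Matrix A₁ A₁ ℂ) (S₂ : Matrix A₂ A₂ ℂ) :
    boxProd (S₁ ⊗ₖ (1 : Matrix B₁ B₁ ℂ)) (S₂ ⊗ₖ (1 : Matrix B₂ B₂ ℂ))
      = (S₁ ⊗ₖ S₂) ⊗ₖ (1 : Matrix (B₁ × B₂) (B₁ × B₂) ℂ) := by
  rw [← one_kronecker_one]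
  ext x y
  simp only [boxProd, Matrix.of_apply, kroneckerMap_apply]
  ring

theorem boxProd_trB (P₁ : Matrix (A₁ × B₁) (A₁ × B₁) ℂ) (P₂ : Matrix (A₂ × B₂) (A₂ × B₂) ℂ) :
    trB (boxProd P₁ P₂) = trB P₁ ⊗ₖ trB P₂ := by
  ext x y
  simp [trB, boxProd, Fintype.sum_prod_type, Finset.sum_mul_sum]

theorem boxProd_trA (P₁ : Matrix (A₁ × B₁) (A₁ × B₁) ℂ) (P₂ : Matrix (A₂ × B₂) (A₂ × B₂) ℂ) :
    trA (boxProd P₁ P₂) = trA P₁ ⊗ₖ trA P₂ := by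
  ext x y
  simp [trA, boxProd, Fintype.sum_prod_type, Finset.sum_mul_sum]

theorem boxProd_isProj {P₁ : Matrix (A₁ × B₁) (A₁ × B₁) ℂ}
    {P₂ : Matrix (A₂ × B₂) (A₂ × B₂) ℂ} (h₁ : IsProj P₁) (h₂ : IsProj P₂) :
    IsProj (boxProd P₁ P₂) := by
  refine ⟨?_, by rw [boxProd_mul, h₁.2, h₂.2]⟩
  ext x y
  simp only [conjTranspose_apply, boxProd, Matrix.of_apply, star_mul']
  rw [h₁.1.apply, h₂.1.apply]

theorem feas_mul [Nonempty B₁] [Nonempty B₂] {P₁ : Matrix (A₁ × B₁) (A₁ × B₁) ℂ}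
    {P₂ : Matrix (A₂ × B₂) (A₂ × B₂) ℂ} {x y : ℝ} (hx : x ∈ feas P₁) (hy : y ∈ feas P₂) :
    x * y ∈ feas (boxProd P₁ P₂) := by
  obtain ⟨S, hS, rfl, E, h0, h1, h2, h3⟩ := hx
  obtain ⟨S', hS', rfl, E', h0', h1', h2', h3'⟩ := hy
  have pS := aux_S_psd h0 h1
  have pS' := aux_S_psd h0' h1'
  unfold loe at h0 h1 h0' h1'
  rw [sub_zero] at h0 h0'
  refine ⟨S ⊗ₖ S', (pS.kronecker pS').1, ?_, boxProd E E', ?_, ?_, ?_, ?_⟩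
  · have i1 : S.trace.im = 0 := (Complex.le_def.1 pS.trace_nonneg).2.symm
    rw [trace_kronecker, Complex.mul_re, i1]
    simp
  · unfold loe
    rw [sub_zero]
    exact boxProd_psd h0 h0'
  · unfold loe
    have e : (S ⊗ₖ S') ⊗ₖ (1 : Matrix (B₁ × B₂) (B₁ × B₂) ℂ) - boxProd E E'
        = boxProd (S ⊗ₖ (1 : Matrix B₁ B₁ ℂ) - E) (S' ⊗ₖ (1 : Matrix B₂ B₂ ℂ))
          + boxProd E (S' ⊗ₖ (1 : Matrix B₂ B₂ ℂ) - E') := by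
      rw [← boxProd_kron]
      ext x y
      simp only [boxProd, Matrix.of_apply, Matrix.sub_apply, Matrix.add_apply]
      ring
    rw [e]
    exact (boxProd_psd h1 (pS'.kronecker PosSemidef.one)).add (boxProd_psd h0 h1')
  · rw [boxProd_trA, h2, h2', one_kronecker_one]
  · rw [Matrix.mul_sub, Matrix.trace_sub, sub_eq_zero] at h3 h3' ⊢
    rw [← boxProd_kron, boxProd_mul, boxProd_mul, boxProd_trace, boxProd_trace, h3, h3']

end prod

/-- The no-signalling assisted independence number is super-multiplicative. -/
theorem upsilon_supermultiplicative
    {A₁ B₁ A₂ B₂ : Type*} [Fintype A₁] [Fintype B₁] [Fintype A₂] [Fintype B₂]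
    [DecidableEq A₁] [DecidableEq B₁] [DecidableEq A₂] [DecidableEq B₂]
    [Nonempty A₁] [Nonempty B₁] [Nonempty A₂] [Nonempty B₂]
    (P₁ : Matrix (A₁ × B₁) (A₁ × B₁) ℂ) (P₂ : Matrix (A₂ × B₂) (A₂ × B₂) ℂ)
    (hP₁ : IsProj P₁) (hP₂ : IsProj P₂) :
    Upsilon (boxProd P₁ P₂) ≥ Upsilon P₁ * Upsilon P₂ := by
  have hnn : ∀ x ∈ feas (boxProd P₁ P₂), 0 ≤ x := fun x hx => feas_nonneg hx
  rw [ge_iff_le, upsilon_eq, upsilon_eq, upsilon_eq]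
  have h0 : 0 ≤ sSup (feas (boxProd P₁ P₂)) := Real.sSup_nonneg hnn
  by_cases h₁ : (trB P₁).PosDef
  swap
  · rwa [Real.sSup_of_not_bddAbove (feas_unbdd hP₁ h₁), zero_mul]
  by_cases h₂ : (trB P₂).PosDef
  swap
  · rwa [Real.sSup_of_not_bddAbove (feas_unbdd hP₂ h₂), mul_zero]
  have hb : BddAbove (feas (boxProd P₁ P₂)) :=
    feas_bdd (boxProd_isProj hP₁ hP₂) (by rw [boxProd_trB]; exact h₁.kronecker h₂)
  have key : ∀ x ∈ feas P₁, x * sSup (feas P₂) ≤ sSup (feas (boxProd P₁ P₂)) := by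
    intro x hx
    have hx0 := feas_nonneg hx
    rcases hx0.eq_or_lt with rfl | hx0
    · simpa using h0
    rw [mul_comm, ← le_div_iff₀ hx0]
    refine Real.sSup_le (fun y hy => ?_) (by positivity)
    rw [le_div_iff₀ hx0, mul_comm]
    exact le_csSup hb (feas_mul hx hy)
  have h20 : 0 ≤ sSup (feas P₂) := Real.sSup_nonneg fun y hy => feas_nonneg hy
  rcases h20.eq_or_lt with h | h
  · rw [← h]; simpa using h0
  rw [← le_div_iff₀ h]
  refine Real.sSup_le (fun y hy => ?_) (by positivity)
  rw [le_div_iff₀ h]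
  exact key y hy
end
end
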